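/- arXiv:2310.14691 — 3 statements merged into one kernel-verified Lean document; each statement's English description precedes it below -/
import Mathlib

section
/- Let G^s be an SCG, t ∈ ℤ, γ ≥ 0 an integer, and X, Y ∈ V distinct with X an ancestor of Y in G^s, and assume the identifiability conditions of Theorem 2 hold (none of the following: (1) γ ≠ 0 and Cycles^>(X, G^s \ {Y}) ≠ ∅; (2) there exists a σ-active (given the empty set) backdoor path π^s = ⟨X, V^2, …, V^{n−1}, Y⟩ in G^s with {V^2, …, V^{n−1}} ⊆ Desc(X, G^s) with (a) n > 2, or (b) n = 2 and γ ≠ 1, or (c) n = 2, γ = 1 and Cycles(Y, G^s) \ {X ⇄ Y} ≠ ∅). Then the reduced set A'_γ = {(W, u) ∈ A_γ : W ∈ Anc(X, G^s) ∪ Anc(Y, G^s)} also satisfies the backdoor criterion over all candidate FTCGs relative to ((X, t−γ), (Y, t)). (Graph-theoretic form of Proposition 2: A'_γ is a valid adjustment set for the total effect.) -/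
/-- `u` is an ancestor of `v` (equivalently, `v` is a descendant of `u`):
there is a possibly empty directed path from `u` to `v` in the directed graph
with edge relation `E`. -/
def Anc {α : Type*} (E : α → α → Prop) (u v : α) : Prop :=
  Relation.ReflTransGen E u v

/-- A directed graph is acyclic if there is no nonempty directed path
from a vertex to itself. -/
def Acyclic {α : Type*} (E : α → α → Prop) : Prop :=
  ∀ v, ¬ Relation.TransGen E v v

/-- A path in a directed graph, given as a sequence of `n + 1` pairwise
distinct vertices `w 0, …, w n` (with `n ≥ 1`) together with a chosen
direction for each step: `dir i = true` means the chosen edge is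
`w i → w (i+1)`, and `dir i = false` means it is `w (i+1) → w i`. -/
structure DPath {α : Type*} (E : α → α → Prop) where
  n : ℕ
  pos : 1 ≤ n
  w : ℕ → α
  dir : ℕ → Bool
  inj : ∀ i j, i ≤ n → j ≤ n → w i = w j → i = j
  valid : ∀ i, i < n →
    (dir i = true → E (w i) (w (i + 1))) ∧ (dir i = false → E (w (i + 1)) (w i))

/-- The path runs between `u` and `v`. -/
def DPath.Between {α : Type*} {E : α → α → Prop} (π : DPath E) (u v : α) : Prop :=
  π.w 0 = u ∧ π.w π.n = v

/-- A backdoor path: the first chosen edge points into the first vertex. -/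
def DPath.Backdoor {α : Type*} {E : α → α → Prop} (π : DPath E) : Prop :=
  π.dir 0 = false

/-- The non-endpoint vertex at position `i` is a collider on the path:
both chosen edges at it point into it. -/
def DPath.ColliderAt {α : Type*} {E : α → α → Prop} (π : DPath E) (i : ℕ) : Prop :=
  0 < i ∧ i < π.n ∧ π.dir (i - 1) = true ∧ π.dir i = false

/-- The non-endpoint vertex at position `i` is a definite non-collider:
at least one of the two chosen edges at it points out of it. -/
def DPath.DefNonColliderAt {α : Type*} {E : α → α → Prop} (π : DPath E) (i : ℕ) : Prop :=
  0 < i ∧ i < π.n ∧ (π.dir (i - 1) = false ∨ π.dir i = true)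

/-- A set `Z` blocks a path if some definite non-collider on the path belongs
to `Z`, or some collider on the path has no descendant in `Z`. -/
def Blocks {α : Type*} {E : α → α → Prop} (Z : Set α) (π : DPath E) : Prop :=
  (∃ i, π.DefNonColliderAt i ∧ π.w i ∈ Z) ∨
  (∃ i, π.ColliderAt i ∧ ∀ z ∈ Z, ¬ Anc E (π.w i) z)

/-- Map a path along an inclusion of edge relations (same vertices, same
chosen directions). -/
def DPath.map {α : Type*} {E E' : α → α → Prop} (h : ∀ a b, E a b → E' a b)
    (π : DPath E) : DPath E' where
  n := π.n
  pos := π.pos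
  w := π.w
  dir := π.dir
  inj := π.inj
  valid := fun i hi =>
    ⟨fun hd => h _ _ ((π.valid i hi).1 hd), fun hd => h _ _ ((π.valid i hi).2 hd)⟩

/-- Temporal priority: every edge goes weakly forward in time, and strictly
forward between two instances of the same time series. -/
def TemporalPriority {V : Type*} (F : V × ℤ → V × ℤ → Prop) : Prop :=
  ∀ A B : V, ∀ s t : ℤ, F (A, s) (B, t) → s ≤ t ∧ (A = B → s < t)

/-- Maximal lag `γmax`: every edge has lag at most `γmax`. -/
def MaxLag {V : Type*} (γmax : ℤ) (F : V × ℤ → V × ℤ → Prop) : Prop :=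
  ∀ A B : V, ∀ s t : ℤ, F (A, s) (B, t) → t - s ≤ γmax

/-- Consistency throughout time: the edge relation is invariant under
simultaneous time shifts. -/
def ConsistentThroughTime {V : Type*} (F : V × ℤ → V × ℤ → Prop) : Prop :=
  ∀ A B : V, ∀ s t k : ℤ, F (A, s) (B, t) ↔ F (A, s + k) (B, t + k)

/-- The extended summary causal graph (ESCG) derived from an FTCG `F`:
vertices `Sum.inl A` represent `A_{t^-}` (past slice) and `Sum.inr A`
represent `A_t` (present slice). -/
def derivedESCG {V : Type*} (γmax : ℤ) (F : V × ℤ → V × ℤ → Prop) :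
    (V ⊕ V) → (V ⊕ V) → Prop
  | Sum.inr A, Sum.inr B => F (A, 0) (B, 0)
  | Sum.inl A, Sum.inr B => ∃ γ : ℤ, 1 ≤ γ ∧ γ ≤ γmax ∧ F (A, -γ) (B, 0)
  | _, _ => False

/-- A candidate FTCG for an ESCG `e`: an FTCG satisfying temporal priority,
maximal lag `γmax`, consistency throughout time and acyclicity whose derived
ESCG is `e`. -/
def CandidateESCG {V : Type*} (γmax : ℤ) (e : (V ⊕ V) → (V ⊕ V) → Prop)
    (F : V × ℤ → V × ℤ → Prop) : Prop :=
  TemporalPriority F ∧ MaxLag γmax F ∧ ConsistentThroughTime F ∧ Acyclic F ∧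
    derivedESCG γmax F = e

/-- The summary causal graph (SCG) derived from an FTCG `F`. -/
def derivedSCG {V : Type*} (γmax : ℤ) (F : V × ℤ → V × ℤ → Prop) : V → V → Prop :=
  fun A B => ∃ t γ : ℤ, 0 ≤ γ ∧ γ ≤ γmax ∧ F (A, t - γ) (B, t)

/-- A candidate FTCG for an SCG `S`. -/
def CandidateSCG {V : Type*} (γmax : ℤ) (S : V → V → Prop)
    (F : V × ℤ → V × ℤ → Prop) : Prop :=
  TemporalPriority F ∧ MaxLag γmax F ∧ ConsistentThroughTime F ∧ Acyclic F ∧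
    derivedSCG γmax F = S

/-- The densest candidate FTCG for an ESCG `e`. -/
def densestFTCG {V : Type*} (γmax : ℤ) (e : (V ⊕ V) → (V ⊕ V) → Prop) :
    V × ℤ → V × ℤ → Prop :=
  fun p q =>
    (p.2 = q.2 ∧ e (Sum.inr p.1) (Sum.inr q.1)) ∨
    (∃ ℓ : ℤ, 1 ≤ ℓ ∧ ℓ ≤ γmax ∧ p.2 = q.2 - ℓ ∧ e (Sum.inl p.1) (Sum.inr q.1))

/-- The adjustment set `B_γ` for an ESCG `e`, variable `X`, time `t`, lag `γ`. -/
def Bset {V : Type*} (γmax : ℤ) (e : (V ⊕ V) → (V ⊕ V) → Prop)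
    (X : V) (t γ : ℤ) : Set (V × ℤ) :=
  {p | (∃ ℓ : ℤ, 1 ≤ ℓ ∧ ℓ ≤ γmax ∧ p.2 = t - γ - ℓ ∧ e (Sum.inl p.1) (Sum.inr X)) ∨
       (p.2 = t - γ ∧ e (Sum.inr p.1) (Sum.inr X))}

/-- The adjustment set `A_γ` for an SCG `S`, variable `X`, time `t`, lag `γ`. -/
def Aset {V : Type*} (γmax : ℤ) (S : V → V → Prop) (X : V) (t γ : ℤ) :
    Set (V × ℤ) :=
  {p | (∃ ℓ : ℤ, 1 ≤ ℓ ∧ ℓ ≤ γmax ∧ p.2 = t - γ - ℓ ∧ Anc S X p.1) ∨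
       (∃ ℓ : ℤ, 0 ≤ ℓ ∧ ℓ ≤ γmax ∧ p.2 = t - γ - ℓ ∧ ¬ Anc S X p.1)}

/-- `Z` satisfies the backdoor criterion over all candidate FTCGs (described
by the predicate `Cand`) relative to `(x, y)`. -/
def SatisfiesBackdoorCriterionAll {V : Type*}
    (Cand : (V × ℤ → V × ℤ → Prop) → Prop)
    (Z : Set (V × ℤ)) (x y : V × ℤ) : Prop :=
  x ∉ Z ∧ y ∉ Z ∧
    ∀ F, Cand F →
      (∀ π : DPath F, π.Between x y → π.Backdoor → Blocks Z π) ∧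
      (∀ p ∈ Z, ¬ Anc F x p)

/-- The standard backdoor criterion relative to `(x, y)` in a single directed
graph: no element of `Z` is a descendant of `x`, and `Z` blocks every
backdoor path between `x` and `y`. -/
def StdBackdoorCriterion {α : Type*} (E : α → α → Prop) (Z : Set α)
    (x y : α) : Prop :=
  (∀ p ∈ Z, ¬ Anc E x p) ∧
  (∀ π : DPath E, π.Between x y → π.Backdoor → Blocks Z π)

/-- The non-endpoint vertex at position `i` σ-blocks the path given the empty
set: the edge into it from its predecessor is present but not reversible, and
likewise from its successor. -/
def DPath.SigmaBlockedAt {α : Type*} {E : α → α → Prop} (π : DPath E) (i : ℕ) : Prop :=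
  0 < i ∧ i < π.n ∧
    (E (π.w (i - 1)) (π.w i) ∧ ¬ E (π.w i) (π.w (i - 1))) ∧
    (E (π.w (i + 1)) (π.w i) ∧ ¬ E (π.w i) (π.w (i + 1)))

/-- A path is σ-active given the empty set if no non-endpoint vertex
σ-blocks it. -/
def DPath.SigmaActive {α : Type*} {E : α → α → Prop} (π : DPath E) : Prop :=
  ∀ i, ¬ π.SigmaBlockedAt i

/-- A directed cycle: vertices `w 0, …, w (m-1)` pairwise distinct, with
`w m = w 0` and edges `w i → w (i+1)`; `m = 1` is a self-loop. -/
structure DCycle {α : Type*} (E : α → α → Prop) where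
  m : ℕ
  pos : 1 ≤ m
  w : ℕ → α
  ret : w m = w 0
  inj : ∀ i j, i < m → j < m → w i = w j → i = j
  valid : ∀ i, i < m → E (w i) (w (i + 1))

/-- The cycle passes through `x`. -/
def DCycle.Through {α : Type*} {E : α → α → Prop} (c : DCycle E) (x : α) : Prop :=
  ∃ i, i < c.m ∧ c.w i = x

/-- `Cycles^>(x, E) ≠ ∅`: there is a directed cycle through `x` with at least
two distinct vertices. -/
def HasBigCycleThrough {α : Type*} (E : α → α → Prop) (x : α) : Prop :=
  ∃ c : DCycle E, c.Through x ∧ 2 ≤ c.m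

/-- The graph obtained by removing vertex `y` and all incident edges. -/
def delVertex {α : Type*} (E : α → α → Prop) (y : α) : α → α → Prop :=
  fun a b => a ≠ y ∧ b ≠ y ∧ E a b

/-- The cycle is the 2-cycle `x ⇄ y`. -/
def DCycle.IsTwoCycle {α : Type*} {E : α → α → Prop} (c : DCycle E) (x y : α) : Prop :=
  c.m = 2 ∧ ((c.w 0 = x ∧ c.w 1 = y) ∨ (c.w 0 = y ∧ c.w 1 = x))

/-- `a` and `b` lie on a common directed cycle of `E`
(`b` lies on a directed cycle through `a`). -/
def OnCommonCycle {α : Type*} (E : α → α → Prop) (a b : α) : Prop :=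
  ∃ c : DCycle E, c.Through a ∧ c.Through b

/-- A path `πf` in a candidate FTCG is compatible with a path `πs` in the SCG
`S` if every intermediate vertex `(W, u)` of `πf` satisfies: `W` is an
intermediate vertex of `πs`, or `W` lies on a directed cycle of `S` through
some intermediate vertex of `πs` but on no directed cycle of `S` through `X`. -/
def Compatible {V : Type*} {F : V × ℤ → V × ℤ → Prop} (S : V → V → Prop) (X : V)
    (πf : DPath F) (πs : DPath S) : Prop :=
  ∀ i, 0 < i → i < πf.n →
    (∃ j, 0 < j ∧ j < πs.n ∧ πs.w j = (πf.w i).1) ∨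
    (∃ j, 0 < j ∧ j < πs.n ∧ OnCommonCycle S (πs.w j) (πf.w i).1 ∧
      ¬ OnCommonCycle S X (πf.w i).1)

/-- A path in a candidate FTCG between `(X, t−γ)` and `(Y, t)` is ambiguous if
all its vertices are at times `≥ t − γ`. -/
def DPath.Ambiguous {V : Type*} {F : V × ℤ → V × ℤ → Prop} (π : DPath F)
    (t γ : ℤ) : Prop :=
  ∀ i, i ≤ π.n → t - γ ≤ (π.w i).2
/-- Reachability is witnessed by a directed walk without repeated vertices. -/
theorem Anc.exists_simple_path {α : Type*} {E : α → α → Prop} {a b : α} (h : Anc E a b) :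
    ∃ (n : ℕ) (w : ℕ → α), w 0 = a ∧ w n = b ∧ (∀ i, i < n → E (w i) (w (i + 1))) ∧
      ∀ i j, i ≤ n → j ≤ n → w i = w j → i = j := by
  classical
  have hex : ∃ (n : ℕ) (w : ℕ → α), w 0 = a ∧ w n = b ∧ ∀ i, i < n → E (w i) (w (i + 1)) := by
    induction h with
    | refl => exact ⟨0, fun _ => a, rfl, rfl, fun i hi => absurd hi (by omega)⟩
    | @tail c d _ hcd ih =>
      obtain ⟨n, w, h0, hn, hE⟩ := ih
      refine ⟨n + 1, fun i => if i ≤ n then w i else d, by simp [h0], by simp, fun i hi => ?_⟩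
      rcases Nat.lt_or_ge i n with hlt | hge
      · have h1 : i ≤ n := by omega
        have h2 : i + 1 ≤ n := by omega
        simpa [h1, h2] using hE i hlt
      · obtain rfl : i = n := by omega
        simpa [hn] using hcd
  obtain ⟨w, h0, hn, hE⟩ := Nat.find_spec hex
  refine ⟨Nat.find hex, w, h0, hn, hE, ?_⟩
  have key : ∀ i j, i < j → j ≤ Nat.find hex → w i ≠ w j := by
    intro i j hij hj heq
    refine Nat.find_min hex (m := Nat.find hex - (j - i)) (by omega)
      ⟨fun m => if m ≤ i then w m else w (m + (j - i)), by simp [h0], ?_, fun m hm => ?_⟩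
    · by_cases hc : Nat.find hex - (j - i) ≤ i
      · have h1 : Nat.find hex - (j - i) = i := by omega
        have h2 : j = Nat.find hex := by omega
        simp only [h1, le_refl, if_true]
        rw [heq, h2, hn]
      · have h1 : Nat.find hex - (j - i) + (j - i) = Nat.find hex := by omega
        simp only [hc, if_false, h1, hn]
    · rcases Nat.lt_trichotomy m i with hlt | rfl | hgt
      · have h1 : m ≤ i := by omega
        have h2 : m + 1 ≤ i := by omega
        simpa [h1, h2] using hE m (by omega)
      · have h1 : m + 1 + (j - m) = j + 1 := by omega
        have h2 : ¬ m + 1 ≤ m := by omega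
        simp only [le_refl, if_true, h2, if_false, h1, heq]
        exact hE j (by omega)
      · have h1 : ¬ m ≤ i := by omega
        have h2 : ¬ m + 1 ≤ i := by omega
        have h3 : m + 1 + (j - i) = m + (j - i) + 1 := by omega
        simp only [h1, h2, if_false, h3]
        exact hE _ (by omega)
  intro i j hi hj heq
  rcases Nat.lt_trichotomy i j with h1 | h1 | h1
  · exact absurd heq (key i j h1 hj)
  · exact h1
  · exact absurd heq.symm (key j i h1 hi)

/-- A simple directed walk closed up by an edge from its last to its first vertex. -/
def DCycle.ofSimplePath {α : Type*} {E : α → α → Prop} (n : ℕ) (w : ℕ → α)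
    (hE : ∀ i, i < n → E (w i) (w (i + 1)))
    (hinj : ∀ i j, i ≤ n → j ≤ n → w i = w j → i = j) (hback : E (w n) (w 0)) : DCycle E where
  m := n + 1
  pos := by omega
  w := fun i => if i ≤ n then w i else w 0
  ret := by simp
  inj := fun i j hi hj h => by
    have h1 : i ≤ n := by omega
    have h2 : j ≤ n := by omega
    simp only [h1, h2, if_true] at h
    exact hinj i j h1 h2 h
  valid := fun i hi => by
    rcases Nat.lt_or_ge i n with hlt | hge
    · have h1 : i ≤ n := by omega
      have h2 : i + 1 ≤ n := by omega
      simpa [h1, h2] using hE i hlt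
    · obtain rfl : i = n := by omega
      simpa using hback

/-- An edge `U → Y` with `U ≠ X` reachable from `Y` lies on a directed cycle through `Y` other
than `X ⇄ Y`. -/
theorem exists_cycle_not_isTwoCycle {α : Type*} {E : α → α → Prop} {X Y U : α}
    (hUX : U ≠ X) (hYU : Anc E Y U) (hUY : E U Y) :
    ∃ c : DCycle E, c.Through Y ∧ ¬ c.IsTwoCycle X Y := by
  obtain ⟨n, w, h0, hn, hE, hinj⟩ := hYU.exists_simple_path
  refine ⟨DCycle.ofSimplePath n w hE hinj (by rw [hn, h0]; exact hUY),
    ⟨0, Nat.succ_pos _, by simpa [DCycle.ofSimplePath] using h0⟩, ?_⟩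
  rintro ⟨hm, hw⟩
  obtain rfl : n = 1 := by simpa [DCycle.ofSimplePath] using hm
  rcases hw with ⟨h1, h2⟩ | ⟨h1, h2⟩
  · simp only [DCycle.ofSimplePath, le_refl, zero_le, if_true] at h1 h2
    exact absurd (hinj 0 1 (by omega) le_rfl (h0.trans h2.symm)) (by omega)
  · simp only [DCycle.ofSimplePath, le_refl, zero_le, if_true] at h1 h2
    exact hUX (hn.symm.trans h2)

/-- A path in which every intermediate vertex has a chosen outgoing edge is σ-active. -/
theorem DPath.sigmaActive_of_no_collider {α : Type*} {E : α → α → Prop} (π : DPath E)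
    (h : ∀ i, ¬ π.ColliderAt i) : π.SigmaActive := by
  rintro i ⟨h0, hn, ⟨_, hl⟩, ⟨_, hr⟩⟩
  have hl' : π.dir (i - 1) = true := by
    by_contra hd
    have := (π.valid (i - 1) (by omega)).2 (by simpa using hd)
    rw [Nat.sub_add_cancel h0] at this
    exact hl this
  have hr' : π.dir i = false := by
    by_contra hd
    exact hr ((π.valid i hn).1 (by simpa using hd))
  exact h i ⟨h0, hn, hl', hr'⟩

/-- If a parent `W ≠ X, Y` of `X` is reachable from `X` and no cycle through `X` avoids `Y`, then
there is a directed path from `Y` to `X` with an intermediate vertex, read as a backdoor path. -/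
theorem exists_long_backdoor_path {α : Type*} {E : α → α → Prop} {X Y W : α}
    (hXY : X ≠ Y) (hWX : W ≠ X) (hWY : W ≠ Y) (hXW : Anc E X W) (hedge : E W X)
    (hcyc : ¬ HasBigCycleThrough (delVertex E Y) X) :
    ∃ π : DPath E, π.Between X Y ∧ π.Backdoor ∧ π.SigmaActive ∧
      (∀ i, 0 < i → i < π.n → Anc E X (π.w i)) ∧ 2 ≤ π.n := by
  obtain ⟨n, w, h0, hn, hE, hinj⟩ := hXW.exists_simple_path
  have hn0 : n ≠ 0 := by
    rintro rfl
    exact hWX (hn.symm.trans h0)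
  have hreach : ∀ i, i ≤ n → Anc E X (w i) := by
    intro i
    induction i with
    | zero => intro _; rw [h0]; exact Relation.ReflTransGen.refl
    | succ i ih => intro hi; exact (ih (by omega)).tail (hE i (by omega))
  by_cases hY : ∃ j, j ≤ n ∧ w j = Y
  · obtain ⟨j, hj, hwj⟩ := hY
    have hj0 : j ≠ 0 := by
      rintro rfl
      exact hXY (h0.symm.trans hwj)
    have hjn : j ≠ n := by
      rintro rfl
      exact hWY (hn.symm.trans hwj)
    let π : DPath E :=
      { n := n - j + 1
        pos := by omega
        w := fun i => if i = 0 then X else w (n + 1 - i)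
        dir := fun _ => false
        inj := by
          intro a b ha hb hab
          by_cases ha0 : a = 0 <;> by_cases hb0 : b = 0 <;>
            simp only [ha0, hb0, if_true, if_false] at hab ⊢
          · have := hinj 0 (n + 1 - b) (by omega) (by omega) (h0.trans hab)
            omega
          · have := hinj (n + 1 - a) 0 (by omega) (by omega) (hab.trans h0.symm)
            omega
          · have := hinj _ _ (by omega) (by omega) hab
            omega
        valid := by
          intro i hi
          refine ⟨fun h => by simp at h, fun _ => ?_⟩
          by_cases hi0 : i = 0
          · subst hi0
            simpa [hn] using hedge
          · have h1 : n + 1 - (i + 1) + 1 = n + 1 - i := by omega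
            have := hE (n + 1 - (i + 1)) (by omega)
            rw [h1] at this
            simpa [hi0] using this }
    refine ⟨π, ⟨rfl, ?_⟩, rfl, π.sigmaActive_of_no_collider ?_, ?_, ?_⟩
    · have h1 : n + 1 - (n - j + 1) = j := by omega
      simp only [π, h1, hwj]
      simp
    · rintro i ⟨_, _, h, _⟩
      simp [π] at h
    · intro i hi _
      have hi0 : i ≠ 0 := by omega
      simp only [π, hi0, if_false]
      exact hreach _ (by omega)
    · change 2 ≤ n - j + 1
      omega
  · have hY' : ∀ j, j ≤ n → w j ≠ Y := fun j hj h => hY ⟨j, hj, h⟩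
    refine absurd ⟨DCycle.ofSimplePath n w
      (fun i hi => ⟨hY' i (by omega), hY' (i + 1) (by omega), hE i hi⟩) hinj
      ⟨hY' n le_rfl, hY' 0 (by omega), by rw [hn, h0]; exact hedge⟩, ⟨0, Nat.succ_pos _, ?_⟩, ?_⟩
      hcyc
    · simpa [DCycle.ofSimplePath] using h0
    · change 2 ≤ n + 1
      omega

section Candidate

variable {V : Type*} {γmax : ℤ} {S : V → V → Prop} {F : V × ℤ → V × ℤ → Prop}

theorem CandidateSCG.time_le (hF : CandidateSCG γmax S F) {p q : V × ℤ} (h : F p q) :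
    p.2 ≤ q.2 :=
  (hF.1 p.1 q.1 p.2 q.2 h).1

theorem CandidateSCG.lag_le (hF : CandidateSCG γmax S F) {p q : V × ℤ} (h : F p q) :
    q.2 - p.2 ≤ γmax :=
  hF.2.1 p.1 q.1 p.2 q.2 h

theorem CandidateSCG.edge (hF : CandidateSCG γmax S F) {p q : V × ℤ} (h : F p q) :
    S p.1 q.1 := by
  have h1 := hF.time_le h
  have h2 := hF.lag_le h
  rw [← hF.2.2.2.2]
  exact ⟨q.2, q.2 - p.2, by omega, h2, by simpa using h⟩

theorem CandidateSCG.anc (hF : CandidateSCG γmax S F) {p q : V × ℤ} (h : Anc F p q) :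
    Anc S p.1 q.1 ∧ p.2 ≤ q.2 := by
  induction h with
  | refl => exact ⟨Relation.ReflTransGen.refl, le_rfl⟩
  | tail _ hbc ih => exact ⟨ih.1.tail (hF.edge hbc), ih.2.trans (hF.time_le hbc)⟩

/-- Every vertex of a path whose colliders are ancestors of `Y` is an ancestor of `Y`, when both
endpoints are. -/
theorem CandidateSCG.path_anc (hF : CandidateSCG γmax S F) (π : DPath F) {Y : V}
    (h0 : Anc S (π.w 0).1 Y) (hn : Anc S (π.w π.n).1 Y)
    (hC : ∀ i, π.ColliderAt i → Anc S (π.w i).1 Y) : ∀ i, i ≤ π.n → Anc S (π.w i).1 Y := by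
  have hright : ∀ k i, i + k = π.n → 0 < k → π.dir i = true → Anc S (π.w i).1 Y := by
    intro k
    induction k with
    | zero => intro i _ h; omega
    | succ k ih =>
      intro i hi _ hd
      refine Relation.ReflTransGen.head (hF.edge ((π.valid i (by omega)).1 hd)) ?_
      rcases Nat.eq_zero_or_pos k with rfl | hk
      · rw [show i + 1 = π.n by omega]
        exact hn
      · cases hd' : π.dir (i + 1) with
        | true => exact ih (i + 1) (by omega) hk hd'
        | false => exact hC (i + 1) ⟨by omega, by omega, hd, hd'⟩
  have hleft : ∀ i, i < π.n → π.dir i = false → Anc S (π.w (i + 1)).1 Y := by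
    intro i
    induction i with
    | zero =>
      intro hi hd
      exact Relation.ReflTransGen.head (hF.edge ((π.valid 0 hi).2 hd)) h0
    | succ i ih =>
      intro hi hd
      refine Relation.ReflTransGen.head (hF.edge ((π.valid (i + 1) hi).2 hd)) ?_
      cases hd' : π.dir i with
      | true => exact hC (i + 1) ⟨by omega, hi, hd', hd⟩
      | false => exact ih (by omega) hd'
  intro i hi
  rcases Nat.eq_zero_or_pos i with rfl | hpos
  · exact h0
  rcases Nat.eq_or_lt_of_le hi with rfl | hlt
  · exact hn
  cases hd : π.dir i with
  | true => exact hright (π.n - i) i (by omega) (by omega) hd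
  | false =>
    cases hd' : π.dir (i - 1) with
    | true => exact hC i ⟨hpos, hlt, hd', hd⟩
    | false =>
      have := hleft (i - 1) (by omega) hd'
      rwa [Nat.sub_add_cancel hpos] at this

/-- A backdoor path not blocked by the reduced set stays at times in `[t - γ, t]`, consists of
descendants of `X`, and has no collider. -/
theorem CandidateSCG.unblocked_path (hF : CandidateSCG γmax S F) {X Y : V} (hanc : Anc S X Y)
    {t γ : ℤ} (hγ : 0 ≤ γ) (π : DPath F) (hb : π.Between (X, t - γ) (Y, t)) (hbd : π.Backdoor)
    (hnb : ¬ Blocks {p ∈ Aset γmax S X t γ | Anc S p.1 X ∨ Anc S p.1 Y} π) :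
    (∀ i, i ≤ π.n → Anc S X (π.w i).1 ∧ t - γ ≤ (π.w i).2 ∧ (π.w i).2 ≤ t) ∧
      (∀ i, i < π.n → π.dir i = false → (π.w (i + 1)).2 = t - γ) ∧
      ∀ i, ¬ π.ColliderAt i := by
  obtain ⟨hw0, hwn⟩ := hb
  simp only [Blocks, not_or, not_exists, not_and, not_forall, not_not] at hnb
  obtain ⟨hNC, hC⟩ := hnb
  have hAY : ∀ i, i ≤ π.n → Anc S (π.w i).1 Y := by
    refine hF.path_anc π (by rw [hw0]; exact hanc) (by rw [hwn]; exact Relation.ReflTransGen.refl)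
      fun i hi => ?_
    obtain ⟨z, hz, hza⟩ := hC i hi
    rcases hz.2 with h | h
    · exact ((hF.anc hza).1.trans h).trans hanc
    · exact (hF.anc hza).1.trans h
  have hlow : ∀ i, i ≤ π.n → t - γ ≤ (π.w i).2 := by
    intro i
    induction i with
    | zero => intro _; rw [hw0]
    | succ i ih =>
      intro hi
      have ih := ih (by omega)
      rcases Nat.eq_or_lt_of_le hi with heq | hlt
      · rw [heq, hwn]
        change t - γ ≤ t
        omega
      cases hd : π.dir i with
      | true => exact ih.trans (hF.time_le ((π.valid i (by omega)).1 hd))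
      | false =>
        by_contra hcon
        have hlag := hF.lag_le ((π.valid i (by omega)).2 hd)
        refine hNC (i + 1) ⟨by omega, hlt, Or.inl hd⟩ ⟨?_, Or.inr (hAY _ hi)⟩
        by_cases hX : Anc S X (π.w (i + 1)).1
        · exact Or.inl ⟨t - γ - (π.w (i + 1)).2, by omega, by omega, by omega, hX⟩
        · exact Or.inr ⟨t - γ - (π.w (i + 1)).2, by omega, by omega, by omega, hX⟩
  have hCX : ∀ i, π.ColliderAt i → ¬ Anc S X (π.w i).1 := by
    intro i hi hX
    obtain ⟨z, hz, hza⟩ := hC i hi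
    obtain ⟨hza, htime⟩ := hF.anc hza
    have hl := hlow i hi.2.1.le
    rcases hz.1 with ⟨ℓ, h1, _, h3, _⟩ | ⟨ℓ, _, _, _, h4⟩
    · omega
    · exact h4 (hX.trans hza)
  have hmain : ∀ i, i < π.n →
      Anc S X (π.w i).1 ∧ (π.dir i = false → (π.w i).2 = t - γ) := by
    intro i
    induction i with
    | zero => intro _; rw [hw0]; exact ⟨Relation.ReflTransGen.refl, fun _ => rfl⟩
    | succ i ih =>
      intro hi
      obtain ⟨ihX, iht⟩ := ih (by omega)
      cases hd : π.dir i with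
      | true =>
        have hX := ihX.tail (hF.edge ((π.valid i (by omega)).1 hd))
        exact ⟨hX, fun hd' => absurd hX (hCX (i + 1) ⟨by omega, hi, hd, hd'⟩)⟩
      | false =>
        have h1 := iht hd
        have h2 := hF.time_le ((π.valid i (by omega)).2 hd)
        have h3 := hlow (i + 1) hi.le
        refine ⟨?_, fun _ => by omega⟩
        by_contra hX
        have hmax := hF.lag_le ((π.valid 0 π.pos).2 hbd)
        have hmax' := hF.time_le ((π.valid 0 π.pos).2 hbd)
        exact hNC (i + 1) ⟨by omega, hi, Or.inl hd⟩
          ⟨Or.inr ⟨0, le_rfl, by omega, by omega, hX⟩, Or.inr (hAY _ hi.le)⟩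
  have hup : ∀ k i, i + k = π.n → (π.w i).2 ≤ t := by
    intro k
    induction k with
    | zero =>
      intro i hi
      rw [show i = π.n by omega, hwn]
    | succ k ih =>
      intro i hi
      cases hd : π.dir i with
      | true => exact (hF.time_le ((π.valid i (by omega)).1 hd)).trans (ih (i + 1) (by omega))
      | false =>
        have := (hmain i (by omega)).2 hd
        omega
  refine ⟨fun i hi => ⟨?_, hlow i hi, hup (π.n - i) i (by omega)⟩, fun i hi hd => ?_,
    fun i hi => hCX i hi (hmain i hi.2.1).1⟩
  · rcases Nat.eq_or_lt_of_le hi with rfl | hlt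
    · rw [hwn]
      exact hanc
    · exact (hmain i hlt).1
  · have h1 := (hmain i hi).2 hd
    have h2 := hF.time_le ((π.valid i hi).2 hd)
    have h3 := hlow (i + 1) hi
    omega

/-- A path of a candidate graph all of whose vertices lie at one time projects to the summary
graph. -/
def DPath.project (π : DPath F) (hF : CandidateSCG γmax S F) (t : ℤ)
    (ht : ∀ i, i ≤ π.n → (π.w i).2 = t) : DPath S where
  n := π.n
  pos := π.pos
  w := fun i => (π.w i).1
  dir := π.dir
  inj := fun i j hi hj h => π.inj i j hi hj (Prod.ext h ((ht i hi).trans (ht j hj).symm))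
  valid := fun i hi =>
    ⟨fun h => hF.edge ((π.valid i hi).1 h), fun h => hF.edge ((π.valid i hi).2 h)⟩

end Candidate

/-- The backdoor path `X ← Y` given by a single edge. -/
def DPath.reverseEdge {α : Type*} {E : α → α → Prop} {X Y : α} (hXY : X ≠ Y) (h : E Y X) :
    DPath E where
  n := 1
  pos := le_rfl
  w := fun i => if i = 0 then X else Y
  dir := fun _ => false
  inj := fun i j hi hj hij => by
    by_cases hi0 : i = 0 <;> by_cases hj0 : j = 0 <;> simp_all; omega
  valid := fun i hi => by
    obtain rfl : i = 0 := by omega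
    simpa using h

/-- Proposition 2, graph-theoretic form: under the
identifiability conditions of Theorem 2, the reduced set
`A'_γ = {(W, u) ∈ A_γ : W ∈ Anc(X, G^s) ∪ Anc(Y, G^s)}` also satisfies the
backdoor criterion over all candidate FTCGs. -/
theorem prop2_reduced_Aset_backdoor_criterion {V : Type*} [Fintype V] [Nonempty V]
    (γmax : ℤ) (hγmax : 1 ≤ γmax)
    (S : V → V → Prop) (X Y : V) (hXY : X ≠ Y) (hanc : Anc S X Y)
    (t γ : ℤ) (hγ : 0 ≤ γ)
    (hcond : ¬ ((γ ≠ 0 ∧ HasBigCycleThrough (delVertex S Y) X) ∨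
      (∃ πs : DPath S, πs.Between X Y ∧ πs.Backdoor ∧ πs.SigmaActive ∧
        (∀ i, 0 < i → i < πs.n → Anc S X (πs.w i)) ∧
        (2 ≤ πs.n ∨ (πs.n = 1 ∧ γ ≠ 1) ∨
          (πs.n = 1 ∧ γ = 1 ∧
            ∃ c : DCycle S, c.Through Y ∧ ¬ c.IsTwoCycle X Y))))) :
    SatisfiesBackdoorCriterionAll (CandidateSCG γmax S)
      {p ∈ Aset γmax S X t γ | Anc S p.1 X ∨ Anc S p.1 Y}
      (X, t - γ) (Y, t) := by
  refine ⟨?_, ?_, fun F hF => ⟨fun π hb hbd => ?_, fun p hp hxp => ?_⟩⟩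
  · rintro ⟨⟨ℓ, h1, _, h3, _⟩ | ⟨ℓ, _, _, _, h4⟩, _⟩
    · change t - γ = t - γ - ℓ at h3
      omega
    · exact h4 Relation.ReflTransGen.refl
  · rintro ⟨⟨ℓ, h1, _, h3, _⟩ | ⟨ℓ, _, _, _, h4⟩, _⟩
    · change t = t - γ - ℓ at h3
      omega
    · exact h4 hanc
  · by_contra hnb
    obtain ⟨hvert, hback, hnc⟩ := hF.unblocked_path hanc hγ π hb hbd hnb
    obtain ⟨hw0, hwn⟩ := hb
    rw [not_or] at hcond
    obtain ⟨hcond1, hcond2⟩ := hcond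
    have hpos := π.pos
    have hF1 : F (π.w 1) (X, t - γ) := hw0 ▸ (π.valid 0 π.pos).2 hbd
    have hS1 : S (π.w 1).1 X := hF.edge hF1
    have hYX : S Y X → γ = 1 ∧ ¬ ∃ c : DCycle S, c.Through Y ∧ ¬ c.IsTwoCycle X Y := by
      intro h
      by_contra hcon
      refine hcond2 ⟨DPath.reverseEdge hXY h, ⟨rfl, rfl⟩, rfl,
        DPath.sigmaActive_of_no_collider _ ?_, ?_, Or.inr ?_⟩
      · rintro i ⟨_, _, hd, _⟩
        simp [DPath.reverseEdge] at hd
      · intro i h0 h1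
        change i < 1 at h1
        omega
      · by_cases h1 : γ = 1
        · exact Or.inr ⟨rfl, h1, not_not.1 fun hc => hcon ⟨h1, hc⟩⟩
        · exact Or.inl ⟨rfl, h1⟩
    by_cases hγ0 : γ = 0
    · have ht : ∀ i, i ≤ π.n → (π.w i).2 = t := fun i hi => by
        have := hvert i hi
        omega
      rcases Nat.eq_or_lt_of_le hpos with h1 | h1
      · rw [h1, hwn] at hS1
        have := (hYX hS1).1
        omega
      · refine hcond2 ⟨π.project hF t ht, ⟨congrArg Prod.fst hw0, congrArg Prod.fst hwn⟩, hbd,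
          DPath.sigmaActive_of_no_collider _ fun i hi => hnc i hi,
          fun i _ hi => (hvert i (Nat.le_of_lt hi)).1, Or.inl h1⟩
    · have hw1t : (π.w 1).2 = t - γ := hback 0 π.pos hbd
      have hw1X : (π.w 1).1 ≠ X := by
        intro h
        have := π.inj 0 1 (by omega) hpos (hw0.trans (Prod.ext h hw1t).symm)
        omega
      by_cases hw1Y : (π.w 1).1 = Y
      · rw [hw1Y] at hS1
        obtain ⟨rfl, hcyc⟩ := hYX hS1
        obtain ⟨m, hm⟩ : ∃ m, π.n = m + 1 := ⟨π.n - 1, by omega⟩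
        have hdir : π.dir m = true := by
          by_contra hd
          have := hback m (by omega) (by simpa using hd)
          rw [← hm, hwn] at this
          change t = t - 1 at this
          omega
        have hlast : F (π.w m) (Y, t) := by
          have := (π.valid m (by omega)).1 hdir
          rwa [← hm, hwn] at this
        obtain ⟨hXm, hlo, hhi⟩ := hvert m (by omega)
        refine hcyc (exists_cycle_not_isTwoCycle (fun hX => ?_)
          (Relation.ReflTransGen.head hS1 hXm) (hF.edge hlast))
        by_cases htm : (π.w m).2 = t
        · have hXt : F (X, t) (Y, t) := by
            rwa [show π.w m = (X, t) from Prod.ext hX htm] at hlast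
          have hYt : F (Y, t) (X, t) := by
            rw [show π.w 1 = (Y, t - 1) from Prod.ext hw1Y hw1t] at hF1
            simpa using (hF.2.2.1 Y X (t - 1) (t - 1) 1).1 hF1
          exact hF.2.2.2.1 _ (Relation.TransGen.tail (Relation.TransGen.single hXt) hYt)
        · have htm' : (π.w m).2 = t - 1 := by omega
          have := π.inj 0 m (by omega) (by omega) (hw0.trans (Prod.ext hX htm').symm)
          subst this
          exact absurd (hbd.symm.trans hdir) (by simp)
      · obtain ⟨πs, hb', hbd', hσ, hdesc, hn⟩ := exists_long_backdoor_path hXY hw1X hw1Y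
          (hvert 1 hpos).1 hS1 fun h => hcond1 ⟨hγ0, h⟩
        exact hcond2 ⟨πs, hb', hbd', hσ, hdesc, Or.inl hn⟩
  · obtain ⟨hX, ht⟩ := hF.anc hxp
    rcases hp.1 with ⟨ℓ, h1, _, h3, _⟩ | ⟨ℓ, _, _, _, h4⟩
    · change t - γ ≤ p.2 at ht
      omega
    · exact h4 hX
end

section
/- Let G^f be an FTCG satisfying temporal priority, maximal lag γ_max and acyclicity. Then the ESCG derived from G^f is an acyclic directed graph (there is no nonempty directed path in the ESCG from a vertex to itself). -/
/-- No vertex of the past slice has an incoming edge in the derived ESCG. -/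
theorem not_derivedESCG_inl {V : Type*} {γmax : ℤ} {F : V × ℤ → V × ℤ → Prop}
    (u : V ⊕ V) (B : V) : ¬ derivedESCG γmax F u (Sum.inl B) := by
  cases u <;> exact id

/-- A nonempty directed path of the derived ESCG that starts in the present slice stays there,
and comes from a path of the FTCG at time `0`. -/
theorem exists_transGen_of_transGen_derivedESCG {V : Type*} {γmax : ℤ}
    {F : V × ℤ → V × ℤ → Prop} {A : V} {w : V ⊕ V}
    (h : Relation.TransGen (derivedESCG γmax F) (Sum.inr A) w) :
    ∃ B, w = Sum.inr B ∧ Relation.TransGen F (A, 0) (B, 0) := by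
  induction h with
  | @single w h =>
    cases w with
    | inl B => exact (not_derivedESCG_inl _ B h).elim
    | inr B => exact ⟨B, rfl, .single h⟩
  | @tail u w _ h ih =>
    obtain ⟨C, rfl, hC⟩ := ih
    cases w with
    | inl B => exact (not_derivedESCG_inl _ B h).elim
    | inr B => exact ⟨B, rfl, hC.tail h⟩

/-- the ESCG derived from an FTCG satisfying temporal priority,
maximal lag `γmax` and acyclicity is an acyclic directed graph. -/
theorem derivedESCG_acyclic {V : Type*} [Fintype V] [Nonempty V]
    (γmax : ℤ) (hγmax : 1 ≤ γmax)
    (F : V × ℤ → V × ℤ → Prop)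
    (htp : TemporalPriority F) (hml : MaxLag γmax F) (hac : Acyclic F) :
    Acyclic (derivedESCG γmax F) := by
  rintro (A | A) h
  · obtain ⟨u, -, hu⟩ := Relation.TransGen.tail'_iff.mp h
    exact not_derivedESCG_inl u A hu
  · obtain ⟨B, hB, hAB⟩ := exists_transGen_of_transGen_derivedESCG h
    obtain rfl := Sum.inr_injective hB
    exact hac _ hAB
end

section
/- Let V = {X, Y, Z} be a type with exactly three distinct elements, let γ_max = 1, and let G^s_1 be the SCG on V with exactly the edges X → Z, Z → X, Z → Y and X → Y. Then for every t ∈ ℤ there is no set W ⊆ V × ℤ with (X,t−1), (Y,t) ∉ W that satisfies the backdoor criterion over all candidate FTCGs relative to ((X,t−1),(Y,t)); in particular, some candidate FTCG for G^s_1 contains the backdoor path ⟨(X,t−1),(Z,t−1),(Y,t)⟩ whose only non-endpoint vertex is (Z,t−1), while in another candidate FTCG (Z,t−1) is a descendant of (X,t−1). (Graph-theoretic content of Example 1: no valid adjustment set identifies P(y_t | do(x_{t−1})) from G^s_1.) -/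
/-- The full-time graph unrolling `S` in which the edge `a → b` is instantaneous
and every other edge has lag one. -/
def instantAt {V : Type*} (S : V → V → Prop) (a b : V) (p q : V × ℤ) : Prop :=
  S p.1 q.1 ∧ ((p.1 = a ∧ q.1 = b ∧ q.2 = p.2) ∨ (¬ (p.1 = a ∧ q.1 = b) ∧ q.2 = p.2 + 1))

theorem acyclic_of_lt {α β : Type*} [Preorder β] {E : α → α → Prop} (f : α → β)
    (hf : ∀ p q, E p q → f p < f q) : Acyclic E := by
  intro v hv
  have key : ∀ w, Relation.TransGen E v w → f v < f w := by
    intro w hw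
    induction hw with
    | single h => exact hf _ _ h
    | tail _ h ih => exact ih.trans (hf _ _ h)
  exact lt_irrefl _ (key v hv)

open scoped Classical in
theorem acyclic_instantAt {V : Type*} {S : V → V → Prop} {a b : V} (hab : a ≠ b) :
    Acyclic (instantAt S a b) := by
  refine acyclic_of_lt (fun p : V × ℤ => 2 * p.2 + if p.1 = b then 1 else 0) ?_
  rintro ⟨A, s⟩ ⟨B, u⟩ ⟨-, ⟨rfl, rfl, h⟩ | ⟨-, h⟩⟩
  · simp only at h
    simp [hab, h]
  · simp only at h ⊢
    split_ifs <;> omega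

theorem derivedSCG_instantAt {V : Type*} (S : V → V → Prop) (a b : V) :
    derivedSCG 1 (instantAt S a b) = S := by
  funext A B
  refine propext ⟨fun ⟨_, _, _, _, h⟩ => h.1, fun h => ?_⟩
  by_cases hAB : A = a ∧ B = b
  · exact ⟨0, 0, le_rfl, zero_le_one, h, Or.inl ⟨hAB.1, hAB.2, rfl⟩⟩
  · exact ⟨0, 1, zero_le_one, le_rfl, h, Or.inr ⟨hAB, rfl⟩⟩

theorem candidateSCG_instantAt {V : Type*} {S : V → V → Prop} {a b : V}
    (hab : a ≠ b) : CandidateSCG 1 S (instantAt S a b) := by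
  refine ⟨?_, ?_, ?_, acyclic_instantAt hab, derivedSCG_instantAt S a b⟩
  · rintro A B s u ⟨-, ⟨rfl, rfl, h⟩ | ⟨-, h⟩⟩
    · exact ⟨h.ge, fun h' => absurd h' hab⟩
    · simp only at h
      exact ⟨by omega, fun _ => by omega⟩
  · rintro A B s u ⟨-, ⟨-, -, h⟩ | ⟨-, h⟩⟩ <;> simp only at h <;> omega
  · intro A B s u k
    have h₀ : u + k = s + k ↔ u = s := by omega
    have h₁ : u + k = s + k + 1 ↔ u = s + 1 := by omega
    simp only [instantAt, h₀, h₁]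

/-- The path `u ← m → v`. -/
def DPath.fork {α : Type*} {E : α → α → Prop} {u m v : α} (hum : u ≠ m) (huv : u ≠ v)
    (hmv : m ≠ v) (hu : E m u) (hv : E m v) : DPath E where
  n := 2
  pos := one_le_two
  w i := if i = 0 then u else if i = 1 then m else v
  dir i := decide (i = 1)
  inj i j hi hj h := by
    interval_cases i <;> interval_cases j <;> simp_all
  valid i hi := by
    interval_cases i <;> simp [hu, hv]

theorem mem_of_blocks_fork {α : Type*} {E : α → α → Prop} {u m v : α} {W : Set α}
    {hum : u ≠ m} {huv : u ≠ v} {hmv : m ≠ v} {hu : E m u} {hv : E m v}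
    (h : Blocks W (DPath.fork hum huv hmv hu hv)) : m ∈ W := by
  rcases h with ⟨i, ⟨h0, h2, -⟩, hW⟩ | ⟨i, ⟨h0, h2, h, -⟩, -⟩
  · obtain rfl : i = 1 := by change i < 2 at h2; omega
    exact hW
  · obtain rfl : i = 1 := by change i < 2 at h2; omega
    exact absurd h Bool.false_ne_true

/-- Example 1, graph-theoretic content: for the SCG `G^s_1`
with edges `X → Z`, `Z → X`, `Z → Y`, `X → Y` on a three-element type and
`γmax = 1`, no set satisfies the backdoor criterion over all candidate FTCGs
relative to `((X, t−1), (Y, t))`; in particular some candidate FTCG contains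
the backdoor path `⟨(X, t−1), (Z, t−1), (Y, t)⟩`, while in another candidate
FTCG `(Z, t−1)` is a descendant of `(X, t−1)`. -/
theorem example1_not_identifiable {V : Type*}
    (x y z : V) (hxy : x ≠ y) (hxz : x ≠ z) (hyz : y ≠ z)
    (hall : ∀ v : V, v = x ∨ v = y ∨ v = z)
    (S : V → V → Prop)
    (hS : ∀ a b, S a b ↔
      ((a = x ∧ b = z) ∨ (a = z ∧ b = x) ∨ (a = z ∧ b = y) ∨ (a = x ∧ b = y)))
    (t : ℤ) :
    (¬ ∃ W : Set (V × ℤ),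
        SatisfiesBackdoorCriterionAll (CandidateSCG 1 S) W (x, t - 1) (y, t)) ∧
    (∃ F, CandidateSCG 1 S F ∧ ∃ π : DPath F,
        π.Between (x, t - 1) (y, t) ∧ π.Backdoor ∧ π.n = 2 ∧
        π.w 1 = (z, t - 1)) ∧
    (∃ F, CandidateSCG 1 S F ∧ Anc F (x, t - 1) (z, t - 1)) := by
  have hzx : S z x := (hS z x).2 (Or.inr (Or.inl ⟨rfl, rfl⟩))
  have hzy : S z y := (hS z y).2 (Or.inr (Or.inr (Or.inl ⟨rfl, rfl⟩)))
  have hSxz : S x z := (hS x z).2 (Or.inl ⟨rfl, rfl⟩)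
  have cand : CandidateSCG 1 S (instantAt S z x) := candidateSCG_instantAt hxz.symm
  have cand' : CandidateSCG 1 S (instantAt S x z) := candidateSCG_instantAt hxz
  have edge_zx : instantAt S z x (z, t - 1) (x, t - 1) := ⟨hzx, Or.inl ⟨rfl, rfl, rfl⟩⟩
  have edge_zy : instantAt S z x (z, t - 1) (y, t) :=
    ⟨hzy, Or.inr ⟨fun h => hxy h.2.symm, (sub_add_cancel t 1).symm⟩⟩
  have anc : Anc (instantAt S x z) (x, t - 1) (z, t - 1) :=
    Relation.ReflTransGen.single ⟨hSxz, Or.inl ⟨rfl, rfl, rfl⟩⟩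
  let π : DPath (instantAt S z x) :=
    DPath.fork (fun h => hxz (congrArg Prod.fst h)) (fun h => hxy (congrArg Prod.fst h))
      (fun h => hyz (congrArg Prod.fst h).symm) edge_zx edge_zy
  refine ⟨?_, ⟨_, cand, π, ⟨rfl, rfl⟩, rfl, rfl, rfl⟩, ⟨_, cand', anc⟩⟩
  rintro ⟨W, -, -, hW⟩
  exact (hW _ cand').2 _ (mem_of_blocks_fork ((hW _ cand).1 π ⟨rfl, rfl⟩ rfl)) anc
end
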